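/- arXiv:2401.12478 — 6 statements merged into one kernel-verified Lean document; each statement's English description precedes it below -/
import Mathlib

section
/- Let F : 2^E → ℝ be a monotone submodular function on a finite ground set E, let k ≥ 1, let S ⊊ E, and let S* ⊆ E with |S*| ≤ k. Then F(S*) ≤ F(S) + k · max_{e ∈ E \ S} F_S(e). -/
open Finset

def Submodular {E : Type*} [DecidableEq E] (F : Finset E → ℝ) : Prop :=
  ∀ S T : Finset E, S ⊆ T → ∀ e ∉ T,
    F (insert e T) - F T ≤ F (insert e S) - F S

def MonotoneSetFn {E : Type*} (F : Finset E → ℝ) : Prop :=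
  ∀ S T : Finset E, S ⊆ T → F S ≤ F T

/-- A submodular function grows on `S ∪ T` by at most `|T|` times any nonnegative bound on the
marginals at `S`. -/
theorem Submodular.union_le_add_card_mul {E : Type*} [DecidableEq E] {F : Finset E → ℝ}
    (hsub : Submodular F) {S : Finset E} {M : ℝ} (hM : 0 ≤ M)
    (hbound : ∀ e ∉ S, F (insert e S) - F S ≤ M) (T : Finset E) :
    F (S ∪ T) ≤ F S + (T.card : ℝ) * M := by
  induction T using Finset.induction_on with
  | empty => simp
  | insert e T he ih =>
    rw [Finset.card_insert_of_notMem he, Finset.union_insert]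
    push_cast
    by_cases h : e ∈ S ∪ T
    · rw [Finset.insert_eq_of_mem h]
      linarith
    · have hS : e ∉ S := fun h' => h (Finset.mem_union_left T h')
      have := hsub S (S ∪ T) Finset.subset_union_left e h
      linarith [hbound e hS]

/-- for a monotone submodular `F`, `k ≥ 1`, `S ⊊ E`, and `S*` with `|S*| ≤ k`,
`F(S*) ≤ F(S) + k · max_{e ∈ E \ S} F_S(e)`. -/
theorem opt_le_plus_k_max_marginal {E : Type*} [Fintype E] [DecidableEq E]
    (F : Finset E → ℝ)
    (hmono : MonotoneSetFn F) (hsub : Submodular F)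
    (k : ℕ) (hk : 1 ≤ k)
    (S : Finset E) (hne : (Finset.univ \ S).Nonempty)
    (Sstar : Finset E) (hSstar : Sstar.card ≤ k) :
    F Sstar ≤ F S +
      (k : ℝ) * (Finset.univ \ S).sup' hne (fun e => F (insert e S) - F S) := by
  have hbound : ∀ e ∉ S, F (insert e S) - F S ≤
      (Finset.univ \ S).sup' hne (fun e => F (insert e S) - F S) := fun e he =>
    Finset.le_sup' (fun e => F (insert e S) - F S) (by simpa using he)
  have hM : 0 ≤ (Finset.univ \ S).sup' hne (fun e => F (insert e S) - F S) := by
    obtain ⟨e, he⟩ := hne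
    have he' : e ∉ S := by simpa using he
    exact (sub_nonneg.mpr (hmono _ _ (Finset.subset_insert e S))).trans (hbound e he')
  calc F Sstar ≤ F (S ∪ Sstar) := hmono _ _ Finset.subset_union_right
    _ ≤ F S + (Sstar.card : ℝ) * _ := hsub.union_le_add_card_mul hM hbound Sstar
    _ ≤ _ := by gcongr
end

section
/- (Per-step progress with an additive approximate oracle.) Let F : 2^E → ℝ be a monotone submodular function on a finite ground set E, let k ≥ 1, ε' ≥ 0, let S ⊊ E, let S* ⊆ E with |S*| ≤ k, and suppose e' ∈ E \ S satisfies F_S(e') ≥ F_S(e) − 2ε'·F(S*) for every e ∈ E \ S. Then F(S ∪ {e'}) − F(S) ≥ (1/k)·((1 − 2ε'k)·F(S*) − F(S)). -/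
open Finset

/-- The gain of adding a set to `S` is at most the sum of the individual marginal gains. -/
theorem Submodular.union_sub_le_sum {E : Type*} [DecidableEq E] {F : Finset E → ℝ}
    (hsub : Submodular F) (hmono : MonotoneSetFn F) (S A : Finset E) :
    F (S ∪ A) - F S ≤ ∑ a ∈ A, (F (insert a S) - F S) := by
  induction A using Finset.induction_on with
  | empty => simp
  | insert a A ha ih =>
    rw [Finset.sum_insert ha, Finset.union_insert]
    by_cases h : a ∈ S ∪ A
    · rw [Finset.insert_eq_of_mem h]
      linarith [hmono S (insert a S) (Finset.subset_insert a S)]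
    · linarith [hsub S (S ∪ A) Finset.subset_union_left a h]

/-- Per-step progress with an additive approximate oracle:
if `e' ∈ E \ S` satisfies `F_S(e') ≥ F_S(e) − 2ε'F(S*)` for every `e ∈ E \ S`, then
`F(S ∪ {e'}) − F(S) ≥ (1/k)((1 − 2ε'k)F(S*) − F(S))`. -/
theorem per_step_progress {E : Type*} [Fintype E] [DecidableEq E]
    (F : Finset E → ℝ)
    (hmono : MonotoneSetFn F) (hsub : Submodular F)
    (k : ℕ) (hk : 1 ≤ k) (ε' : ℝ) (hε' : 0 ≤ ε')
    (S : Finset E) (hS : S ⊂ Finset.univ)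
    (Sstar : Finset E) (hSstar : Sstar.card ≤ k)
    (e' : E) (he' : e' ∉ S)
    (horacle : ∀ e : E, e ∉ S →
      F (insert e' S) - F S ≥ (F (insert e S) - F S) - 2 * ε' * F Sstar) :
    F (insert e' S) - F S ≥
      (1 / (k : ℝ)) * ((1 - 2 * ε' * k) * F Sstar - F S) := by
  have hc : 0 ≤ 2 * ε' * F Sstar := by linarith [horacle e' he']
  have hgain : 0 ≤ F (insert e' S) - F S :=
    sub_nonneg.2 (hmono S (insert e' S) (Finset.subset_insert e' S))
  have hsum : ∑ e ∈ Sstar, (F (insert e S) - F S) ≤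
      Sstar.card • (F (insert e' S) - F S + 2 * ε' * F Sstar) := by
    refine Finset.sum_le_card_nsmul _ _ _ fun e _ => ?_
    by_cases h : e ∈ S
    · rw [Finset.insert_eq_of_mem h]
      linarith
    · linarith [horacle e h]
  rw [nsmul_eq_mul] at hsum
  have hcard : (Sstar.card : ℝ) * (F (insert e' S) - F S + 2 * ε' * F Sstar) ≤
      k * (F (insert e' S) - F S + 2 * ε' * F Sstar) :=
    mul_le_mul_of_nonneg_right (by exact_mod_cast hSstar) (by linarith)
  have hk0 : (0 : ℝ) < k := by exact_mod_cast hk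
  rw [ge_iff_le, one_div, inv_mul_le_iff₀ hk0]
  linarith [hsub.union_sub_le_sum hmono S Sstar,
    hmono Sstar (S ∪ Sstar) Finset.subset_union_right]
end

section
/- (Greedy with an additive ε'-approximate incremental oracle under a cardinality constraint.) Let F : 2^E → ℝ be a non-negative monotone submodular function with F(∅) = 0 on a finite ground set E with |E| = n, let 1 ≤ k ≤ n, and let S* maximize F over all subsets of E of size at most k. Let ε ∈ [0, 1] and ε' ≤ ε/(2k). Suppose S_1 = ∅ and, for j = 1, …, k, S_{j+1} = S_j ∪ {e_j} where e_j ∈ E \ S_j satisfies F_{S_j}(e_j) ≥ F_{S_j}(e) − 2ε'·F(S*) for every e ∈ E \ S_j (as is guaranteed when e_j maximizes an additive ε'-approximate incremental oracle over E \ S_j). Then F(S_{k+1}) ≥ (1 − 1/e − ε)·F(S*). -/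
open Finset

theorem Submodular.union_le_add_sum {E : Type*} [DecidableEq E] {F : Finset E → ℝ}
    (hF : Submodular F) (S T : Finset E) :
    F (S ∪ T) ≤ F S + ∑ x ∈ T \ S, (F (insert x S) - F S) := by
  induction T using Finset.induction_on with
  | empty => simp
  | insert a T ha ih =>
    by_cases haS : a ∈ S
    · rwa [union_insert, insert_eq_of_mem (mem_union_left _ haS), insert_sdiff_of_mem _ haS]
    · rw [union_insert, insert_sdiff_of_notMem _ haS, sum_insert (by simp [ha])]
      linarith [hF S (S ∪ T) subset_union_left a (by simp [ha, haS])]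

/-- One greedy step with additive slack `δ` closes a `1 / k` fraction of the gap to any competitor
of size at most `k`, up to `δ`. -/
theorem Submodular.le_add_mul_of_greedy {E : Type*} [DecidableEq E] {F : Finset E → ℝ}
    (hF : Submodular F) (hmono : MonotoneSetFn F) {k : ℕ} {S T : Finset E} (hT : T.card ≤ k)
    {a : E} {δ : ℝ} (hδ : 0 ≤ δ)
    (ha : ∀ x ∉ S, F (insert x S) - F S - δ ≤ F (insert a S) - F S) :
    F T ≤ F S + k * (F (insert a S) - F S + δ) := by
  have hsum : ∑ x ∈ T \ S, (F (insert x S) - F S) ≤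
      (T \ S).card • (F (insert a S) - F S + δ) :=
    sum_le_card_nsmul _ _ _ fun x hx => by linarith [ha x (mem_sdiff.mp hx).2]
  have hcard : ((T \ S).card : ℝ) ≤ k := by
    exact_mod_cast (card_le_card sdiff_subset).trans hT
  have hgain : 0 ≤ F (insert a S) - F S + δ := by
    linarith [hmono S (insert a S) (subset_insert a S)]
  rw [nsmul_eq_mul] at hsum
  linarith [hmono T (S ∪ T) subset_union_right, hF.union_le_add_sum S T,
    mul_le_mul_of_nonneg_right hcard hgain]

/-- Greedy with an additive ε'-approximate incremental oracle, cardinality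
constraint: if every chosen element `e_j` satisfies
`F_{S_j}(e_j) ≥ F_{S_j}(e) − 2ε'F(S*)` for every candidate `e`, with `ε' ≤ ε/(2k)`, then
`F(S_{k+1}) ≥ (1 − 1/e − ε)·F(S*)`. -/
theorem greedy_additive_oracle_cardinality {E : Type*} [Fintype E] [DecidableEq E]
    (F : Finset E → ℝ)
    (hnonneg : ∀ S, 0 ≤ F S) (hmono : MonotoneSetFn F) (hsub : Submodular F)
    (hempty : F ∅ = 0)
    (k : ℕ) (hk1 : 1 ≤ k) (hkn : k ≤ Fintype.card E)
    (Sstar : Finset E) (hSstar_card : Sstar.card ≤ k)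
    (hSstar_opt : ∀ T : Finset E, T.card ≤ k → F T ≤ F Sstar)
    (ε ε' : ℝ) (hε0 : 0 ≤ ε) (hε1 : ε ≤ 1) (hε' : ε' ≤ ε / (2 * k))
    (S : ℕ → Finset E) (e : ℕ → E)
    (hS1 : S 1 = ∅)
    (hstep : ∀ j, 1 ≤ j → j ≤ k →
      e j ∉ S j ∧ S (j + 1) = insert (e j) (S j) ∧
      ∀ x : E, x ∉ S j →
        F (insert (e j) (S j)) - F (S j) ≥
          (F (insert x (S j)) - F (S j)) - 2 * ε' * F Sstar) :
    F (S (k + 1)) ≥ (1 - 1 / Real.exp 1 - ε) * F Sstar := by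
  have hk : (1 : ℝ) ≤ k := by exact_mod_cast hk1
  have hk0 : (0 : ℝ) < k := by linarith
  have hopt := hnonneg Sstar
  have hq : 0 ≤ 1 - 1 / (k : ℝ) := by
    rw [sub_nonneg, div_le_one hk0]
    exact hk
  set δ : ℝ := ε / k * F Sstar with hδ
  have hδ0 : 0 ≤ δ := by positivity
  have hslack : 2 * ε' * F Sstar ≤ δ := by
    refine mul_le_mul_of_nonneg_right ?_ hopt
    calc 2 * ε' ≤ 2 * (ε / (2 * k)) := by linarith
      _ = ε / k := by field_simp
  have hgap : ∀ j ≤ k,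
      F Sstar - F (S (j + 1)) ≤ (1 - 1 / (k : ℝ)) ^ j * F Sstar + j * δ := by
    intro j
    induction j with
    | zero => simp [hS1, hempty]
    | succ j ih =>
      intro hj
      obtain ⟨-, hS, hgreedy⟩ := hstep (j + 1) (by omega) hj
      have hprogress := hsub.le_add_mul_of_greedy hmono hSstar_card (S := S (j + 1))
        (a := e (j + 1)) hδ0 fun x hx => by linarith [hgreedy x hx]
      rw [← hS] at hprogress
      have hcontract : F Sstar - F (S (j + 1 + 1)) ≤
          (1 - 1 / (k : ℝ)) * (F Sstar - F (S (j + 1))) + δ := by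
        have hdiv : (F Sstar - F (S (j + 1))) / k ≤
            F (S (j + 1 + 1)) - F (S (j + 1)) + δ := by
          rw [div_le_iff₀ hk0]
          linarith
        linear_combination hdiv
      have hstep_mul := mul_le_mul_of_nonneg_left (ih (by omega)) hq
      have hdrop : 0 ≤ 1 / (k : ℝ) * (j * δ) := by positivity
      rw [pow_succ]
      push_cast
      linear_combination hcontract + hstep_mul + hdrop
  have hexp : (1 - 1 / (k : ℝ)) ^ k ≤ 1 / Real.exp 1 := by
    rw [one_div (Real.exp 1), ← Real.exp_neg]
    exact Real.one_sub_div_pow_le_exp_neg hk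
  have hkδ : k * δ = ε * F Sstar := by
    rw [hδ]
    field_simp
  linear_combination hgap k le_rfl + mul_le_mul_of_nonneg_right hexp hopt + hkδ
end

section
/- (Partition lemma for p-systems.) Let (E, I) be a p-system with p ≥ 1. Let ∅ = S_1 ⊂ S_2 ⊂ … ⊂ S_{k+1} with S_{j+1} = S_j ∪ {e_j} for distinct elements e_1, …, e_k, suppose each S_j ∈ I, and suppose S_{k+1} is an inclusion-maximal member of I (i.e., S_{k+1} ∈ B(E)). Then for every S* ∈ I there exists a partition S*_1, …, S*_k of S* such that |S*_j| ≤ p for every j ∈ [k], and for every j ∈ [k] and every e ∈ S*_j, S_j ∪ {e} ∈ I. -/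
open Finset

/-- An independence system: `∅ ∈ I` and `I` is downward closed. -/
def IndepSystem {E : Type*} (I : Set (Finset E)) : Prop :=
  ∅ ∈ I ∧ ∀ A ∈ I, ∀ B ⊆ A, B ∈ I

/-- `A ∈ B(E')`: `A` is an inclusion-maximal member of `I` contained in `E'`. -/
def IsBasisIn {E : Type*} (I : Set (Finset E)) (E' A : Finset E) : Prop :=
  A ∈ I ∧ A ⊆ E' ∧ ∀ A' ∈ I, A ⊆ A' → A' ⊆ E' → A' = A

/-- `(E, I)` is a `p`-system: for every `E' ⊆ E`, the ratio of sizes of any two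
inclusion-maximal independent subsets of `E'` is at most `p`. -/
def PSystem {E : Type*} (I : Set (Finset E)) (p : ℕ) : Prop :=
  IndepSystem I ∧
    ∀ E' A B : Finset E, IsBasisIn I E' A → IsBasisIn I E' B → A.card ≤ p * B.card

/-- In a `p`-system, an independent set `T` none of whose elements outside `A` extends `A`
has at most `p * A.card` elements. -/
theorem PSystem.card_le_of_forall_insert_notMem {E : Type*} [DecidableEq E]
    {I : Set (Finset E)} {p : ℕ} (hI : PSystem I p) {A T : Finset E} (hA : A ∈ I) (hT : T ∈ I)
    (h : ∀ x ∈ T, x ∉ A → insert x A ∉ I) : T.card ≤ p * A.card := by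
  have hfin : {B | B ∈ I ∧ B ⊆ A ∪ T}.Finite :=
    (A ∪ T).powerset.finite_toSet.subset fun B hB => mem_coe.2 (mem_powerset.2 hB.2)
  obtain ⟨B, hTB, hB⟩ := hfin.exists_le_maximal
    (show T ∈ {B | B ∈ I ∧ B ⊆ A ∪ T} from ⟨hT, subset_union_right⟩)
  have hBbasis : IsBasisIn I (A ∪ T) B :=
    ⟨hB.prop.1, hB.prop.2, fun A' hA' hBA' hA'E => hB.eq_of_ge ⟨hA', hA'E⟩ hBA'⟩
  have hAbasis : IsBasisIn I (A ∪ T) A := by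
    refine ⟨hA, subset_union_left, fun A' hA' hAA' hA'E => Subset.antisymm (fun x hx => ?_) hAA'⟩
    by_contra hxA
    exact h x ((mem_union.1 (hA'E hx)).resolve_left hxA) hxA
      (hI.1.2 A' hA' _ (insert_subset hx hAA'))
  exact (card_le_card hTB).trans (hI.2 _ _ _ hBbasis hAbasis)

/-- If `S 1, …, S n` are independent with `(S j).card + 1 = j`, then an independent set with at
most `p * n` elements splits into `n` parts of size at most `p`, every element of the `j`-th part
being addable to `S j`. -/
theorem PSystem.exists_partition_of_card_le {E : Type*} [DecidableEq E]
    {I : Set (Finset E)} {p : ℕ} (hI : PSystem I p) (S : ℕ → Finset E) (n : ℕ)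
    (hS : ∀ j ∈ Icc 1 n, S j ∈ I ∧ (S j).card + 1 = j) (T : Finset E) (hT : T ∈ I)
    (hcard : T.card ≤ p * n) : ∃ P : ℕ → Finset E,
      ((Icc 1 n).biUnion P = T) ∧
      (∀ j1 ∈ Icc 1 n, ∀ j2 ∈ Icc 1 n, j1 ≠ j2 → Disjoint (P j1) (P j2)) ∧
      (∀ j ∈ Icc 1 n, (P j).card ≤ p) ∧
      (∀ j ∈ Icc 1 n, ∀ x ∈ P j, insert x (S j) ∈ I) := by
  classical
  induction n generalizing T with
  | zero => exact ⟨fun _ => ∅, by simp_all⟩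
  | succ n ih =>
    obtain ⟨hSI, hScard⟩ := hS (n + 1) (by simp)
    obtain ⟨C, hCB, hC⟩ := exists_subset_card_eq
      (min_le_right p (T.filter fun x => insert x (S (n + 1)) ∈ I).card)
    have hCT : C ⊆ T := hCB.trans (filter_subset _ _)
    have hTC : T \ C ∈ I := hI.1.2 T hT _ sdiff_subset
    have hle : (T \ C).card ≤ p * n := by
      rcases le_total p (T.filter fun x => insert x (S (n + 1)) ∈ I).card with hp | hp
      · rw [min_eq_left hp] at hC
        rw [card_sdiff_of_subset hCT, hC, Nat.sub_le_iff_le_add]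
        exact hcard
      · rw [min_eq_right hp] at hC
        have hCeq := eq_of_subset_of_card_le hCB hC.ge
        have := hI.card_le_of_forall_insert_notMem hSI hTC fun x hx _ hxI =>
          (mem_sdiff.1 hx).2 (hCeq ▸ mem_filter.2 ⟨(mem_sdiff.1 hx).1, hxI⟩)
        rwa [Nat.add_right_cancel hScard] at this
    obtain ⟨P, hU, hD, hP, hx⟩ :=
      ih (fun j hj => hS j (Icc_subset_Icc_right n.le_succ hj)) _ hTC hle
    have hsub : ∀ j ∈ Icc 1 n, Disjoint (P j) C := fun j hj =>
      disjoint_of_subset_left ((subset_biUnion_of_mem P hj).trans hU.subset) sdiff_disjoint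
    have hnew : Function.update P (n + 1) C (n + 1) = C := Function.update_self ..
    have hold : ∀ j ∈ Icc 1 n, Function.update P (n + 1) C j = P j := fun j hj =>
      Function.update_of_ne (by have := mem_Icc.1 hj; omega) ..
    have hIcc : Icc 1 (n + 1) = insert (n + 1) (Icc 1 n) :=
      (insert_Icc_right_eq_Icc_add_one (by omega)).symm
    refine ⟨Function.update P (n + 1) C, ?_, ?_, ?_, ?_⟩ <;> rw [hIcc]
    · rw [biUnion_insert, hnew, biUnion_congr rfl hold, hU, union_sdiff_of_subset hCT]
    · intro i hi j hj hij
      rcases mem_insert.1 hi with rfl | hi <;> rcases mem_insert.1 hj with rfl | hj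
      · exact absurd rfl hij
      · rw [hnew, hold j hj]
        exact (hsub j hj).symm
      · rw [hnew, hold i hi]
        exact hsub i hi
      · rw [hold i hi, hold j hj]
        exact hD i hi j hj hij
    · intro j hj
      rcases mem_insert.1 hj with rfl | hj
      · rw [hnew, hC]
        exact min_le_left _ _
      · rw [hold j hj]
        exact hP j hj
    · intro j hj
      rcases mem_insert.1 hj with rfl | hj
      · rw [hnew]
        exact fun x hxC => (mem_filter.1 (hCB hxC)).2
      · rw [hold j hj]
        exact hx j hj

/-- Partition lemma for p-systems: if `∅ = S_1 ⊂ ⋯ ⊂ S_{k+1}` is a greedy chain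
of independent sets with `S_{k+1}` maximal, then every `S* ∈ I` admits a partition
`S*_1, …, S*_k` with `|S*_j| ≤ p` and `S_j ∪ {e} ∈ I` for every `e ∈ S*_j`. -/
theorem psystem_partition {E : Type*} [Fintype E] [DecidableEq E]
    (I : Set (Finset E)) (p : ℕ) (hp : 1 ≤ p) (hI : PSystem I p)
    (k : ℕ) (S : ℕ → Finset E) (e : ℕ → E)
    (hS1 : S 1 = ∅)
    (hstep : ∀ j, 1 ≤ j → j ≤ k → e j ∉ S j ∧ S (j + 1) = insert (e j) (S j))
    (hind : ∀ j, 1 ≤ j → j ≤ k + 1 → S j ∈ I)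
    (hmax : IsBasisIn I Finset.univ (S (k + 1))) :
    ∀ Sstar ∈ I, ∃ P : ℕ → Finset E,
      ((Finset.Icc 1 k).biUnion P = Sstar) ∧
      (∀ j1 ∈ Finset.Icc 1 k, ∀ j2 ∈ Finset.Icc 1 k, j1 ≠ j2 → Disjoint (P j1) (P j2)) ∧
      (∀ j ∈ Finset.Icc 1 k, (P j).card ≤ p) ∧
      (∀ j ∈ Finset.Icc 1 k, ∀ x ∈ P j, insert x (S j) ∈ I) := by
  intro Sstar hSstar
  have hcard : ∀ j ≤ k, (S (j + 1)).card = j := by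
    intro j
    induction j with
    | zero => simp [hS1]
    | succ j ih =>
      intro hj
      obtain ⟨hnot, heq⟩ := hstep (j + 1) (by omega) hj
      rw [heq, card_insert_of_notMem hnot, ih (by omega)]
  refine hI.exists_partition_of_card_le S k (fun j hj => ?_) Sstar hSstar ?_
  · obtain ⟨h1, hk⟩ := mem_Icc.1 hj
    obtain ⟨i, rfl⟩ := Nat.exists_eq_add_of_le' h1
    exact ⟨hind _ h1 (by omega), by rw [hcard i (by omega)]⟩
  · have := hI.card_le_of_forall_insert_notMem hmax.1 hSstar fun x _ hx hxI =>
      hx (hmax.2.2 _ hxI (subset_insert _ _) (subset_univ _) ▸ mem_insert_self _ _)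
    rwa [hcard k le_rfl] at this
end

section
/- (Accounting inequality for the p-system greedy analysis.) Let F : 2^E → ℝ be a non-negative monotone submodular function with F(∅) = 0 on a finite ground set E, let p ≥ 1, ε' ≥ 0, k ≥ 1. Let ∅ = S_1 ⊂ S_2 ⊂ … ⊂ S_{k+1} with S_{j+1} = S_j ∪ {e_j} for distinct e_1, …, e_k, write S = S_{k+1}, and let S* ⊆ E admit a partition S*_1, …, S*_k such that for every j ∈ [k], F_{S_j}(e_j) ≥ (1/p)·F_S(S*_j) − 2ε'·F(S*). Then F(S) ≥ ((1 − 2pε'k)/(p + 1))·F(S*). -/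
open Finset

/-- Diminishing returns of a monotone submodular function for adding a whole set. -/
theorem Submodular.union_sub_le {E : Type*} [DecidableEq E] {F : Finset E → ℝ}
    (hsub : Submodular F) (hmono : MonotoneSetFn F) {S T : Finset E} (hST : S ⊆ T)
    (A : Finset E) : F (T ∪ A) - F T ≤ F (S ∪ A) - F S := by
  induction A using Finset.induction_on with
  | empty => simp
  | insert a A _ ih =>
    rw [Finset.union_insert, Finset.union_insert]
    by_cases ha : a ∈ T ∪ A
    · rw [Finset.insert_eq_self.mpr ha]
      linarith [hmono _ _ (Finset.subset_insert a (S ∪ A))]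
    · linarith [hsub (S ∪ A) (T ∪ A) (Finset.union_subset_union_left hST) a ha]

/-- The marginal value of a union is at most the sum of the marginal values. -/
theorem Submodular.union_biUnion_sub_le_sum {E ι : Type*} [DecidableEq E]
    {F : Finset E → ℝ} (hsub : Submodular F) (hmono : MonotoneSetFn F) (T : Finset E)
    (s : Finset ι) (P : ι → Finset E) :
    F (T ∪ s.biUnion P) - F T ≤ ∑ i ∈ s, (F (T ∪ P i) - F T) := by
  classical
  induction s using Finset.induction_on with
  | empty => simp
  | insert i s hi ih =>
    rw [Finset.sum_insert hi, Finset.biUnion_insert, Finset.union_comm (P i),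
      ← Finset.union_assoc]
    linarith [hsub.union_sub_le hmono
      (Finset.subset_union_left : T ⊆ T ∪ s.biUnion P) (P i)]

/-- Accounting inequality for the p-system greedy analysis: if
`S = S_{k+1}` comes from a chain `∅ = S_1 ⊂ ⋯ ⊂ S_{k+1}` with `S_{j+1} = S_j ∪ {e_j}`, and
`S*` has a partition `S*_1, …, S*_k` with
`F_{S_j}(e_j) ≥ (1/p)·F_S(S*_j) − 2ε'·F(S*)` for every `j`, then
`F(S) ≥ ((1 − 2pε'k)/(p+1))·F(S*)`. -/
theorem psystem_accounting {E : Type*} [Fintype E] [DecidableEq E]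
    (F : Finset E → ℝ)
    (hnonneg : ∀ S, 0 ≤ F S) (hmono : MonotoneSetFn F) (hsub : Submodular F)
    (hempty : F ∅ = 0)
    (p : ℕ) (hp : 1 ≤ p) (ε' : ℝ) (hε' : 0 ≤ ε') (k : ℕ) (hk : 1 ≤ k)
    (S : ℕ → Finset E) (e : ℕ → E)
    (hS1 : S 1 = ∅)
    (hstep : ∀ j, 1 ≤ j → j ≤ k → e j ∉ S j ∧ S (j + 1) = insert (e j) (S j))
    (Sstar : Finset E) (P : ℕ → Finset E)
    (hPunion : (Finset.Icc 1 k).biUnion P = Sstar)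
    (hPdisj : ∀ j1 ∈ Finset.Icc 1 k, ∀ j2 ∈ Finset.Icc 1 k, j1 ≠ j2 → Disjoint (P j1) (P j2))
    (hPbound : ∀ j, 1 ≤ j → j ≤ k →
      F (insert (e j) (S j)) - F (S j) ≥
        (1 / (p : ℝ)) * (F (S (k + 1) ∪ P j) - F (S (k + 1))) - 2 * ε' * F Sstar) :
    F (S (k + 1)) ≥ ((1 - 2 * p * ε' * k) / (p + 1)) * F Sstar := by
  have htel : ∑ j ∈ Finset.Icc 1 k, (F (insert (e j) (S j)) - F (S j)) = F (S (k + 1)) := by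
    have h : ∑ j ∈ Finset.Icc 1 k, (F (insert (e j) (S j)) - F (S j)) =
        ∑ j ∈ Finset.Ico 1 (k + 1), (F (S (j + 1)) - F (S j)) := by
      refine Finset.sum_congr (by ext; simp) fun j hj => ?_
      obtain ⟨h1, h2⟩ := Finset.mem_Ico.mp hj
      rw [(hstep j h1 (by omega)).2]
    rw [h, Finset.sum_Ico_sub (fun j => F (S j)) (by omega), hS1, hempty, sub_zero]
  have hsum := Finset.sum_le_sum fun j (hj : j ∈ Finset.Icc 1 k) =>
    hPbound j (Finset.mem_Icc.mp hj).1 (Finset.mem_Icc.mp hj).2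
  rw [htel, Finset.sum_sub_distrib, ← Finset.mul_sum, Finset.sum_const, Nat.card_Icc,
    Nat.add_sub_cancel, nsmul_eq_mul] at hsum
  have hunion := hsub.union_biUnion_sub_le_sum hmono (S (k + 1)) (Finset.Icc 1 k) P
  rw [hPunion] at hunion
  have hle : F Sstar ≤ F (S (k + 1) ∪ Sstar) := hmono _ _ Finset.subset_union_right
  have hp0 : (0 : ℝ) < p := by exact_mod_cast hp
  have hscaled := mul_le_mul_of_nonneg_left hsum hp0.le
  rw [mul_sub, ← mul_assoc, mul_one_div_cancel hp0.ne', one_mul] at hscaled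
  rw [ge_iff_le, div_mul_eq_mul_div, div_le_iff₀ (by positivity)]
  linarith
end

section
/- (Greedy with a (1−ε)-approximate incremental oracle under a p-system constraint.) Let (E, I) be a p-system with p ≥ 1, let F : 2^E → ℝ be a non-negative monotone submodular function with F(∅) = 0, and let S* maximize F over I. Let ε ∈ [0, 1]. Suppose S_1 = ∅ and, for j = 1, …, k, letting A_j = {e ∈ E \ S_j : S_j ∪ {e} ∈ I}, the element e_j ∈ A_j satisfies F_{S_j}(e_j) ≥ (1 − ε)·F_{S_j}(e) for every e ∈ A_j, and S_{j+1} = S_j ∪ {e_j}; suppose moreover that the output S = S_{k+1} is an inclusion-maximal member of I. Then F(S) ≥ ((1 − ε)/(p + 1))·F(S*). -/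
open Finset

/-- Every independent subset of `E'` extends to a basis of `E'`. -/
theorem exists_isBasisIn_superset {E : Type*} [Finite E] {I : Set (Finset E)} {E' T : Finset E}
    (hT : T ∈ I) (hTE : T ⊆ E') : ∃ A, IsBasisIn I E' A ∧ T ⊆ A := by
  obtain ⟨A, hTA, hA⟩ := (Set.toFinite {A : Finset E | A ∈ I ∧ A ⊆ E'}).exists_le_maximal
    (show T ∈ {A : Finset E | A ∈ I ∧ A ⊆ E'} from ⟨hT, hTE⟩)
  exact ⟨A, ⟨hA.prop.1, hA.prop.2, fun A' hA' hAA' hE' =>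
    (hA.eq_of_le ⟨hA', hE'⟩ hAA').symm⟩, hTA⟩

/-- In a `p`-system, a basis of `E'` is at most `p` times smaller than any independent subset. -/
theorem PSystem.card_le_mul_card_of_isBasisIn {E : Type*} [Finite E] {I : Set (Finset E)} {p : ℕ}
    (hI : PSystem I p) {E' T B : Finset E} (hT : T ∈ I) (hTE : T ⊆ E') (hB : IsBasisIn I E' B) :
    T.card ≤ p * B.card := by
  obtain ⟨A, hA, hTA⟩ := exists_isBasisIn_superset hT hTE
  exact (card_le_card hTA).trans (hI.2 E' A B hA hB)

/-- If no element of `T` can be added to `B` while keeping independence, then `B` is a basis of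
`B ∪ T`. -/
theorem IndepSystem.isBasisIn_union {E : Type*} [DecidableEq E] {I : Set (Finset E)}
    (hI : IndepSystem I) {B T : Finset E} (hB : B ∈ I) (h : ∀ x ∈ T, insert x B ∉ I) :
    IsBasisIn I (B ∪ T) B := by
  refine ⟨hB, subset_union_left, fun A' hA' hBA' hA'U => (hBA'.antisymm fun x hx => ?_).symm⟩
  refine (mem_union.1 (hA'U hx)).resolve_right fun hxT => h x hxT ?_
  exact hI.2 A' hA' _ (insert_subset hx hBA')

/-- Marginal values of a monotone submodular function are antitone in the set. -/
theorem Submodular.marginal_le {E : Type*} [DecidableEq E] {F : Finset E → ℝ}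
    (hsub : Submodular F) (hmono : MonotoneSetFn F) {S T : Finset E} (hST : S ⊆ T) (x : E) :
    F (insert x T) - F T ≤ F (insert x S) - F S := by
  by_cases hx : x ∈ T
  · rw [insert_eq_of_mem hx, sub_self]
    exact sub_nonneg.2 (hmono _ _ (subset_insert x S))
  · exact hsub S T hST x hx

theorem Submodular.le_add_sum_marginals {E : Type*} [DecidableEq E] {F : Finset E → ℝ}
    (hsub : Submodular F) (hmono : MonotoneSetFn F) (S T : Finset E) :
    F (S ∪ T) ≤ F S + ∑ x ∈ T, (F (insert x S) - F S) := by
  induction T using Finset.induction_on with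
  | empty => simp
  | insert x T hx ih =>
    rw [sum_insert hx, union_insert]
    have hgain := hsub.marginal_le hmono (subset_union_left : S ⊆ S ∪ T) x
    linarith

/-- In a `p`-system, an independent set `T` of size at most `p * (|B| + 1)` contains at most `p`
elements, each of which can be added to `B`, whose removal leaves at most `p * |B|` elements. -/
theorem PSystem.exists_addable_subset {E : Type*} [Finite E] [DecidableEq E]
    {I : Set (Finset E)} {p : ℕ} (hI : PSystem I p) {B T : Finset E} (hB : B ∈ I) (hT : T ∈ I)
    (hcard : T.card ≤ p * (B.card + 1)) :
    ∃ O ⊆ T, (∀ x ∈ O, insert x B ∈ I) ∧ O.card ≤ p ∧ (T \ O).card ≤ p * B.card := by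
  classical
  rcases le_total p (T.filter fun x => insert x B ∈ I).card with hp | hp
  · obtain ⟨O, hO, hOp⟩ := exists_subset_card_eq hp
    refine ⟨O, hO.trans (filter_subset _ _), fun x hx => (mem_filter.1 (hO hx)).2, hOp.le, ?_⟩
    rw [card_sdiff_of_subset (hO.trans (filter_subset _ _)), hOp]
    rw [mul_add, mul_one] at hcard
    omega
  · refine ⟨_, filter_subset _ _, fun x hx => (mem_filter.1 hx).2, hp, ?_⟩
    refine hI.card_le_mul_card_of_isBasisIn (hI.1.2 T hT _ sdiff_subset) subset_union_right
      (hI.1.isBasisIn_union hB fun x hx hxI => ?_)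
    obtain ⟨hxT, hxO⟩ := mem_sdiff.1 hx
    exact hxO (mem_filter.2 ⟨hxT, hxI⟩)

/-- Greedy with a (1−ε)-approximate incremental oracle, p-system constraint:
under a p-system, greedy steps chosen within a multiplicative `(1−ε)` factor produce, upon
reaching a maximal independent set, a solution with `F(S) ≥ ((1−ε)/(p+1))·F(S*)`. -/
theorem greedy_multiplicative_oracle_psystem {E : Type*} [Fintype E] [DecidableEq E]
    (I : Set (Finset E)) (p : ℕ) (hp : 1 ≤ p) (hI : PSystem I p)
    (F : Finset E → ℝ)
    (hnonneg : ∀ S, 0 ≤ F S) (hmono : MonotoneSetFn F) (hsub : Submodular F)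
    (hempty : F ∅ = 0)
    (Sstar : Finset E) (hSstar_mem : Sstar ∈ I)
    (hSstar_opt : ∀ T ∈ I, F T ≤ F Sstar)
    (k : ℕ) (hk : 1 ≤ k)
    (ε : ℝ) (hε0 : 0 ≤ ε) (hε1 : ε ≤ 1)
    (S : ℕ → Finset E) (e : ℕ → E)
    (hS1 : S 1 = ∅)
    (hstep : ∀ j, 1 ≤ j → j ≤ k →
      (e j ∉ S j ∧ insert (e j) (S j) ∈ I) ∧
      S (j + 1) = insert (e j) (S j) ∧
      ∀ x : E, x ∉ S j → insert x (S j) ∈ I →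
        F (insert (e j) (S j)) - F (S j) ≥
          (1 - ε) * (F (insert x (S j)) - F (S j)))
    (hmax : IsBasisIn I Finset.univ (S (k + 1))) :
    F (S (k + 1)) ≥ ((1 - ε) / (p + 1)) * F Sstar := by
  have hstate : ∀ m ≤ k, S (m + 1) ∈ I ∧ (S (m + 1)).card = m := by
    intro m
    induction m with
    | zero => exact fun _ => by simpa [hS1] using hI.1.1
    | succ m ih =>
      intro hm
      obtain ⟨⟨hnotMem, hindep⟩, hnext, -⟩ := hstep (m + 1) (by omega) hm
      rw [hnext, card_insert_of_notMem hnotMem, (ih (by omega)).2]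
      exact ⟨hindep, rfl⟩
  have hsubset : ∀ m ≤ k, S (m + 1) ⊆ S (k + 1) := by
    intro m hm
    induction hm using Nat.decreasingInduction with
    | self => exact Subset.rfl
    | of_succ m hm ih =>
      obtain ⟨-, hnext, -⟩ := hstep (m + 1) (by omega) hm
      exact (hnext ▸ subset_insert _ _).trans ih
  have hcharge : ∀ m ≤ k, ∀ T ∈ I, T.card ≤ p * m →
      (1 - ε) * ∑ x ∈ T, (F (insert x (S (k + 1))) - F (S (k + 1))) ≤ p * F (S (m + 1)) := by
    intro m
    induction m with
    | zero =>
      intro _ T _ hT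
      obtain rfl : T = ∅ := by simpa using hT
      simp [hS1, hempty]
    | succ m ih =>
      intro hm T hT hTcard
      obtain ⟨hmem, hcard⟩ := hstate m (by omega)
      obtain ⟨-, hnext, hgreedy⟩ := hstep (m + 1) (by omega) hm
      obtain ⟨O, hOT, hO, hOp, hrest⟩ :=
        hI.exists_addable_subset hmem hT (by rwa [hcard])
      have hIH := ih (by omega) (T \ O) (hI.1.2 T hT _ sdiff_subset) (by rwa [hcard] at hrest)
      have hgain : 0 ≤ F (S (m + 1 + 1)) - F (S (m + 1)) :=
        sub_nonneg.2 (hmono _ _ (hnext ▸ subset_insert _ _))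
      have hO_le : ∑ x ∈ O, (1 - ε) * (F (insert x (S (k + 1))) - F (S (k + 1))) ≤
          O.card • (F (S (m + 1 + 1)) - F (S (m + 1))) := by
        refine sum_le_card_nsmul _ _ _ fun x hx => ?_
        refine (mul_le_mul_of_nonneg_left
          (hsub.marginal_le hmono (hsubset m (by omega)) x) (sub_nonneg.2 hε1)).trans ?_
        by_cases hxS : x ∈ S (m + 1)
        · simpa [insert_eq_of_mem hxS] using hgain
        · rw [hnext]
          exact hgreedy x hxS (hO x hx)
      rw [← mul_sum, nsmul_eq_mul] at hO_le
      have hOp_le := mul_le_mul_of_nonneg_right (Nat.cast_le (α := ℝ).2 hOp) hgain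
      rw [← sum_sdiff hOT, mul_add]
      linarith
  have hstar_card : Sstar.card ≤ p * k := by
    have := hI.card_le_mul_card_of_isBasisIn hSstar_mem (subset_univ _) hmax
    rwa [(hstate k le_rfl).2] at this
  have hsum := hcharge k le_rfl Sstar hSstar_mem hstar_card
  have hstar := (hmono _ _ subset_union_right).trans
    (hsub.le_add_sum_marginals hmono (S (k + 1)) Sstar)
  have hscaled := mul_le_mul_of_nonneg_left hstar (sub_nonneg.2 hε1)
  have hεF := mul_nonneg hε0 (hnonneg (S (k + 1)))
  rw [ge_iff_le, div_mul_eq_mul_div, div_le_iff₀ (by positivity)]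
  linarith
end
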